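/- arXiv:1911.12892 — 2 statements merged into one kernel-verified Lean document; each statement's English description precedes it below -/
import Mathlib

section
/- Suppose c > 0, θ* > π/6, and c² ≤ (π²/(θ1 − θ0)²)(4 sin²θ* − 1)/(4 − sin²θ*). Let λ, Λ ∈ ℝ admit twice continuously differentiable positive Dirichlet solutions: h1 > 0 on (θ0,θ1), h1(θ0) = h1(θ1) = 0, h1'' + (λ (csc θ)² − c²) h1 = 0; and h2 > 0 on (θ0,θ1), h2(θ0) = h2(θ1) = 0, h2'' + (Λ (csc θ)² − 4c²) h2 = 0. Set a = cosh(π/c) + cos²θ* and η = cos²θ*/sinh(π/c) + √(1 − sin⁴θ*)/(a + √(a² − 1)), and let D = D_{c,θ0,θ1} be the diameter of Ω_{c,θ0,θ1}. Then sin²(θ*) · (1 + (c/π) ln(csc θ*))² < (Λ − λ) · D² / (3π²) < (1 + (c/π)(2 ln(csc θ*) + η))². -/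
open Real Set

/-- Hyperbolic distance in the Poincaré upper half-plane:
`cosh (dist p q) = 1 + ((x₂-x₁)² + (y₂-y₁)²)/(2 y₁ y₂)`. -/
noncomputable def hDist (p q : ℝ × ℝ) : ℝ :=
  Real.log ((1 + ((q.1 - p.1) ^ 2 + (q.2 - p.2) ^ 2) / (2 * p.2 * q.2)) +
    Real.sqrt ((1 + ((q.1 - p.1) ^ 2 + (q.2 - p.2) ^ 2) / (2 * p.2 * q.2)) ^ 2 - 1))

/-- Diameter of a set with respect to the hyperbolic distance. -/
noncomputable def hDiam (S : Set (ℝ × ℝ)) : ℝ :=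
  sSup {d : ℝ | ∃ p ∈ S, ∃ q ∈ S, d = hDist p q}

/-- The domain `Ω_{c,θ0,θ1}` in polar coordinates. -/
def Omega (c θ0 θ1 : ℝ) : Set (ℝ × ℝ) :=
  {p | ∃ r θ : ℝ, 1 < r ∧ r < Real.exp (π / c) ∧ θ0 < θ ∧ θ < θ1 ∧
    p = (r * Real.cos θ, r * Real.sin θ)}

/-- The quantity whose inverse hyperbolic cosine is the distance, in polar coordinates. -/
lemma polar_cosh_eq {r ρ α β : ℝ} (hr : 0 < r) (hρ : 0 < ρ) (hα : 0 < sin α) (hβ : 0 < sin β) :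
    1 + ((ρ * cos β - r * cos α) ^ 2 + (ρ * sin β - r * sin α) ^ 2) /
        (2 * (r * sin α) * (ρ * sin β)) =
      ((r / ρ + ρ / r) / 2 - cos α * cos β) / (sin α * sin β) := by
  field_simp
  have h1 := sin_sq_add_cos_sq α
  have h2 := sin_sq_add_cos_sq β
  linear_combination r ^ 2 * h1 + ρ ^ 2 * h2

lemma hDist_polar {r ρ α β : ℝ} (hr : 0 < r) (hρ : 0 < ρ) (hα : 0 < sin α) (hβ : 0 < sin β) :
    hDist (r * cos α, r * sin α) (ρ * cos β, ρ * sin β) =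
      log (((r / ρ + ρ / r) / 2 - cos α * cos β) / (sin α * sin β) +
        sqrt ((((r / ρ + ρ / r) / 2 - cos α * cos β) / (sin α * sin β)) ^ 2 - 1)) := by
  simp only [hDist]
  rw [polar_cosh_eq hr hρ hα hβ]

lemma one_le_polar_cosh {r ρ α β : ℝ} (hr : 0 < r) (hρ : 0 < ρ) (hα : 0 < sin α)
    (hβ : 0 < sin β) :
    1 ≤ ((r / ρ + ρ / r) / 2 - cos α * cos β) / (sin α * sin β) := by
  rw [← polar_cosh_eq hr hρ hα hβ]
  have : 0 ≤ ((ρ * cos β - r * cos α) ^ 2 + (ρ * sin β - r * sin α) ^ 2) /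
      (2 * (r * sin α) * (ρ * sin β)) := by positivity
  linarith

lemma log_add_sqrt_mono {x y : ℝ} (hx : 1 ≤ x) (hxy : x ≤ y) :
    log (x + sqrt (x ^ 2 - 1)) ≤ log (y + sqrt (y ^ 2 - 1)) := by
  have h0 := sqrt_nonneg (x ^ 2 - 1)
  apply log_le_log (by linarith)
  gcongr

lemma log_add_sqrt_cosh {x : ℝ} (hx : 0 ≤ x) :
    log (cosh x + sqrt (cosh x ^ 2 - 1)) = x := by
  have h : cosh x ^ 2 - 1 = sinh x ^ 2 := by linarith [cosh_sq x]
  rw [h, sqrt_sq (sinh_nonneg_iff.2 hx), cosh_add_sinh, log_exp]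

lemma cosh_add_mul_sinh_le {x t : ℝ} (hx : 0 ≤ x) (ht : 0 ≤ t) :
    cosh x + t * sinh x ≤ cosh (x + t) := by
  rw [cosh_add]
  have h1 : t ≤ sinh t := self_le_sinh_iff.2 ht
  have h2 := one_le_cosh t
  have h3 : 0 ≤ sinh x := sinh_nonneg_iff.2 hx
  have h4 := cosh_pos x
  nlinarith

lemma log_cosh_add_le {x u : ℝ} (hx : 0 < x) (hu : 0 ≤ u) :
    log (cosh x + u + sqrt ((cosh x + u) ^ 2 - 1)) ≤ x + u / sinh x := by
  have hs : 0 < sinh x := sinh_pos_iff.2 hx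
  have ht : 0 ≤ u / sinh x := by positivity
  have h := cosh_add_mul_sinh_le hx.le ht
  rw [div_mul_cancel₀ _ hs.ne'] at h
  have h1 := one_le_cosh x
  calc _ ≤ _ := log_add_sqrt_mono (by linarith) h
    _ = _ := log_add_sqrt_cosh (by positivity)

lemma log_div_sq_add_sqrt_le {a s : ℝ} (ha : 1 ≤ a) (hs : 0 < s) (hs1 : s ≤ 1) :
    log (a / s ^ 2 + sqrt ((a / s ^ 2) ^ 2 - 1)) ≤
      2 * log s⁻¹ + log (a + sqrt (a ^ 2 - 1)) +
        sqrt (1 - s ^ 4) / (a + sqrt (a ^ 2 - 1)) := by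
  set b := a + sqrt (a ^ 2 - 1) with hb
  set e := sqrt (1 - s ^ 4) with he
  have hb0 : 0 < b := by have := sqrt_nonneg (a ^ 2 - 1); linarith
  have he0 : 0 ≤ e := sqrt_nonneg _
  have hs4 : s ^ 4 ≤ 1 := pow_le_one₀ hs.le hs1
  have h1 : sqrt ((a / s ^ 2) ^ 2 - 1) = sqrt (a ^ 2 - s ^ 4) / s ^ 2 := by
    have : (a / s ^ 2) ^ 2 - 1 = (a ^ 2 - s ^ 4) / (s ^ 2) ^ 2 := by field_simp
    rw [this, sqrt_div' _ (by positivity), sqrt_sq (by positivity)]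
  have h2 : sqrt (a ^ 2 - s ^ 4) ≤ sqrt (a ^ 2 - 1) + e := by
    have : a ^ 2 - s ^ 4 = (a ^ 2 - 1) + (1 - s ^ 4) := by ring
    rw [this]
    rw [sqrt_le_left (by positivity), add_sq, sq_sqrt (by nlinarith), he, sq_sqrt (by linarith)]
    have := mul_nonneg (sqrt_nonneg (a ^ 2 - 1)) (sqrt_nonneg (1 - s ^ 4))
    linarith
  have h3 : a / s ^ 2 + sqrt ((a / s ^ 2) ^ 2 - 1) ≤ s⁻¹ ^ 2 * (b * (1 + e / b)) := by
    have hbe : b * (1 + e / b) = b + e := by field_simp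
    rw [h1, ← add_div, hbe, inv_pow, ← div_eq_inv_mul]
    have : a + sqrt (a ^ 2 - s ^ 4) ≤ b + e := by linarith
    gcongr
  have h4 : 0 < a / s ^ 2 + sqrt ((a / s ^ 2) ^ 2 - 1) := by positivity
  have h5 : 0 < 1 + e / b := by positivity
  calc _ ≤ log (s⁻¹ ^ 2 * (b * (1 + e / b))) := log_le_log h4 h3
    _ = 2 * log s⁻¹ + log b + log (1 + e / b) := by
      rw [log_mul (by positivity) (by positivity), log_mul hb0.ne' h5.ne', log_pow]
      push_cast; ring
    _ ≤ _ := by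
      have := log_le_sub_one_of_pos h5
      linarith

lemma add_log_inv_le {x s : ℝ} (hs : 0 < s) (hs1 : s ≤ 1) :
    x + log s⁻¹ ≤ log (cosh x / s + sqrt ((cosh x / s) ^ 2 - 1)) := by
  have h1 : exp x / s ≤ cosh x / s + sqrt ((cosh x / s) ^ 2 - 1) := by
    have h : sinh x / s ≤ sqrt ((cosh x / s) ^ 2 - 1) := by
      apply le_sqrt_of_sq_le
      rw [div_pow, div_pow, cosh_sq, add_div]
      have : 1 ≤ 1 / s ^ 2 := by
        rw [le_div_iff₀ (by positivity)]
        have := pow_le_one₀ (n := 2) hs.le hs1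
        linarith
      linarith
    rw [← cosh_add_sinh, add_div]
    linarith
  calc x + log s⁻¹ = log (exp x / s) := by
        rw [div_eq_mul_inv, log_mul (exp_pos x).ne' (by positivity), log_exp]
    _ ≤ _ := log_le_log (by positivity) h1

lemma div_add_div_le_of_mem_Ioo {E r ρ : ℝ} (hr : r ∈ Ioo 1 E) (hρ : ρ ∈ Ioo 1 E) :
    r / ρ + ρ / r ≤ E + E⁻¹ := by
  obtain ⟨h1, h2⟩ := hr
  obtain ⟨h3, h4⟩ := hρ
  have hE : 0 < E := by linarith
  have a1 : 0 ≤ E * ρ - r := by nlinarith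
  have a2 : 0 ≤ E * r - ρ := by nlinarith
  have : E + E⁻¹ - (r / ρ + ρ / r) = (E * ρ - r) * (E * r - ρ) / (E * r * ρ) := by
    have : 0 < r := by linarith
    have : 0 < ρ := by linarith
    field_simp
    ring
  have h5 : 0 ≤ (E * ρ - r) * (E * r - ρ) / (E * r * ρ) := by positivity
  linarith

lemma sin_min_lt {θ0 θ1 θ : ℝ} (hθ0 : θ0 ∈ Ioo 0 (π / 2)) (hθ1 : θ1 ∈ Ioo (π / 2) π)
    (hθ : θ ∈ Ioo θ0 θ1) : sin (min θ0 (π - θ1)) < sin θ := by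
  obtain ⟨h1, h2⟩ := hθ0
  obtain ⟨h3, h4⟩ := hθ1
  obtain ⟨h5, h6⟩ := hθ
  have m1 := min_le_left θ0 (π - θ1)
  have m2 := min_le_right θ0 (π - θ1)
  have m3 : 0 < min θ0 (π - θ1) := lt_min h1 (by linarith)
  rcases le_total θ (π / 2) with h | h
  · exact sin_lt_sin_of_lt_of_le_pi_div_two (by linarith) h (by linarith)
  · rw [← sin_pi_sub θ]
    exact sin_lt_sin_of_lt_of_le_pi_div_two (by linarith) (by linarith) (by linarith)

lemma sin_min_pos {θ0 θ1 : ℝ} (hθ0 : θ0 ∈ Ioo 0 (π / 2)) (hθ1 : θ1 ∈ Ioo (π / 2) π) :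
    0 < sin (min θ0 (π - θ1)) := by
  obtain ⟨h1, h2⟩ := hθ0
  obtain ⟨h3, h4⟩ := hθ1
  exact sin_pos_of_pos_of_lt_pi (lt_min h1 (by linarith))
    (lt_of_le_of_lt (min_le_left _ _) (by linarith))

lemma hDist_le_of_mem_Omega {c θ0 θ1 : ℝ} (hθ0 : θ0 ∈ Ioo 0 (π / 2))
    (hθ1 : θ1 ∈ Ioo (π / 2) π) (hc : 0 < c) {p q : ℝ × ℝ} (hp : p ∈ Omega c θ0 θ1)
    (hq : q ∈ Omega c θ0 θ1) :
    hDist p q ≤ π / c + 2 * log (sin (min θ0 (π - θ1)))⁻¹ +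
      (cos (min θ0 (π - θ1)) ^ 2 / sinh (π / c) +
        sqrt (1 - sin (min θ0 (π - θ1)) ^ 4) /
          (cosh (π / c) + cos (min θ0 (π - θ1)) ^ 2 +
            sqrt ((cosh (π / c) + cos (min θ0 (π - θ1)) ^ 2) ^ 2 - 1))) := by
  obtain ⟨r, α, hr1, hr2, hα1, hα2, rfl⟩ := hp
  obtain ⟨ρ, β, hρ1, hρ2, hβ1, hβ2, rfl⟩ := hq
  have hsα := sin_min_lt hθ0 hθ1 ⟨hα1, hα2⟩
  have hsβ := sin_min_lt hθ0 hθ1 ⟨hβ1, hβ2⟩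
  have hs := sin_min_pos hθ0 hθ1
  set θs := min θ0 (π - θ1)
  have hr : 0 < r := by linarith
  have hρ : 0 < ρ := by linarith
  have hα := hs.trans hsα
  have hβ := hs.trans hsβ
  have hcosh : (r / ρ + ρ / r) / 2 ≤ cosh (π / c) := by
    rw [cosh_eq, exp_neg]
    linarith [div_add_div_le_of_mem_Ioo ⟨hr1, hr2⟩ ⟨hρ1, hρ2⟩]
  have hcos : -(cos α * cos β) ≤ cos θs ^ 2 := by
    have e1 : cos α ^ 2 ≤ cos θs ^ 2 := by
      rw [cos_sq', cos_sq']; gcongr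
    have e2 : cos β ^ 2 ≤ cos θs ^ 2 := by
      rw [cos_sq', cos_sq']; gcongr
    nlinarith [sq_nonneg (cos α + cos β)]
  have hX : ((r / ρ + ρ / r) / 2 - cos α * cos β) / (sin α * sin β) ≤
      (cosh (π / c) + cos θs ^ 2) / sin θs ^ 2 := by
    have h1 := one_le_cosh (π / c)
    rw [sq (sin θs)]
    gcongr
    linarith
  rw [hDist_polar hr hρ hα hβ]
  have h1 := log_add_sqrt_mono (one_le_polar_cosh hr hρ hα hβ) hX
  have h2 := log_div_sq_add_sqrt_le (a := cosh (π / c) + cos θs ^ 2)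
    (by have := one_le_cosh (π / c); nlinarith [sq_nonneg (cos θs)]) hs (sin_le_one θs)
  have h3 := log_cosh_add_le (x := π / c) (by positivity) (sq_nonneg (cos θs))
  linarith

lemma Omega_nonempty {c θ0 θ1 : ℝ} (hθ0 : θ0 < π / 2) (hθ1 : π / 2 < θ1) (hc : 0 < c) :
    (Omega c θ0 θ1).Nonempty := by
  have : (1 : ℝ) < exp (π / c) := one_lt_exp_iff.2 (by positivity)
  obtain ⟨r, hr1, hr2⟩ := exists_between this
  exact ⟨_, r, π / 2, hr1, hr2, hθ0, hθ1, rfl⟩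

lemma hDiam_Omega_le {c θ0 θ1 : ℝ} (hθ0 : θ0 ∈ Ioo 0 (π / 2))
    (hθ1 : θ1 ∈ Ioo (π / 2) π) (hc : 0 < c) :
    hDiam (Omega c θ0 θ1) ≤ π / c + 2 * log (sin (min θ0 (π - θ1)))⁻¹ +
      (cos (min θ0 (π - θ1)) ^ 2 / sinh (π / c) +
        sqrt (1 - sin (min θ0 (π - θ1)) ^ 4) /
          (cosh (π / c) + cos (min θ0 (π - θ1)) ^ 2 +
            sqrt ((cosh (π / c) + cos (min θ0 (π - θ1)) ^ 2) ^ 2 - 1))) := by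
  obtain ⟨p, hp⟩ := Omega_nonempty hθ0.2 hθ1.1 hc
  refine csSup_le ⟨_, p, hp, p, hp, rfl⟩ ?_
  rintro _ ⟨p, hp, q, hq, rfl⟩
  exact hDist_le_of_mem_Omega hθ0 hθ1 hc hp hq

lemma hDist_le_hDiam_Omega {c θ0 θ1 : ℝ} (hθ0 : θ0 ∈ Ioo 0 (π / 2))
    (hθ1 : θ1 ∈ Ioo (π / 2) π) (hc : 0 < c) {p q : ℝ × ℝ} (hp : p ∈ Omega c θ0 θ1)
    (hq : q ∈ Omega c θ0 θ1) : hDist p q ≤ hDiam (Omega c θ0 θ1) := by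
  obtain ⟨M, hM⟩ : ∃ M, ∀ p ∈ Omega c θ0 θ1, ∀ q ∈ Omega c θ0 θ1, hDist p q ≤ M :=
    ⟨_, fun _ hp _ hq => hDist_le_of_mem_Omega hθ0 hθ1 hc hp hq⟩
  refine le_csSup ⟨M, ?_⟩ ⟨p, hp, q, hq, rfl⟩
  rintro _ ⟨p, hp, q, hq, rfl⟩
  exact hM p hp q hq

lemma add_log_inv_sin_le_hDiam_Omega {c θ0 θ1 τ : ℝ} (hθ0 : θ0 ∈ Ioo 0 (π / 2))
    (hθ1 : θ1 ∈ Ioo (π / 2) π) (hc : 0 < c) (hτ : τ ∈ Icc θ0 θ1) :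
    π / c + log (sin τ)⁻¹ ≤ hDiam (Omega c θ0 θ1) := by
  have hL : 0 < π / c := by positivity
  have hsτ : 0 < sin τ :=
    sin_pos_of_pos_of_lt_pi (by linarith [hτ.1, hθ0.1]) (by linarith [hτ.2, hθ1.2])
  let f : ℝ → ℝ := fun t => π / c * (1 - 2 * t) + log (sin (τ + t * (π / 2 - τ)))⁻¹
  have hf : ContinuousAt f 0 := by
    have : (sin (τ + 0 * (π / 2 - τ))) ≠ 0 := by simpa using hsτ.ne'
    have h2 : (sin (τ + 0 * (π / 2 - τ)))⁻¹ ≠ 0 := inv_ne_zero this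
    fun_prop (disch := assumption)
  have hf0 : f 0 = π / c + log (sin τ)⁻¹ := by simp [f]
  rw [← hf0]
  refine le_of_tendsto (hf.tendsto.mono_left (nhdsWithin_le_nhds (s := Ioi 0))) ?_
  filter_upwards [Ioo_mem_nhdsGT (zero_lt_one' ℝ)] with t ht
  obtain ⟨ht0, ht1⟩ := ht
  have hω : τ + t * (π / 2 - τ) ∈ Ioo θ0 θ1 := by
    obtain ⟨h1, h2⟩ := hτ
    have h3 := hθ0.2
    have h4 := hθ1.1
    constructor <;> nlinarith
  set ω := τ + t * (π / 2 - τ)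
  have hsω : 0 < sin ω :=
    sin_pos_of_pos_of_lt_pi (by linarith [hω.1, hθ0.1]) (by linarith [hω.2, hθ1.2])
  have hp : (exp (π / c * t) * cos ω, exp (π / c * t) * sin ω) ∈ Omega c θ0 θ1 :=
    ⟨_, ω, one_lt_exp_iff.2 (by positivity), exp_lt_exp.2 (by nlinarith), hω.1, hω.2, rfl⟩
  have hq : (exp (π / c * (1 - t)) * cos (π / 2), exp (π / c * (1 - t)) * sin (π / 2)) ∈
      Omega c θ0 θ1 :=
    ⟨_, π / 2, one_lt_exp_iff.2 (mul_pos hL (by linarith)), exp_lt_exp.2 (by nlinarith),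
      hθ0.2, hθ1.1, rfl⟩
  refine le_trans ?_ (hDist_le_hDiam_Omega hθ0 hθ1 hc hp hq)
  rw [hDist_polar (exp_pos _) (exp_pos _) hsω (by simp)]
  have hX : ((exp (π / c * t) / exp (π / c * (1 - t)) + exp (π / c * (1 - t)) / exp (π / c * t))
      / 2 - cos ω * cos (π / 2)) / (sin ω * sin (π / 2)) =
      cosh (π / c * (1 - 2 * t)) / sin ω := by
    rw [← exp_sub, ← exp_sub, cosh_eq, cos_pi_div_two, sin_pi_div_two]
    ring_nf
  rw [hX]
  exact add_log_inv_le hsω (sin_le_one ω)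

lemma add_log_inv_sin_min_le_hDiam_Omega {c θ0 θ1 : ℝ} (hθ0 : θ0 ∈ Ioo 0 (π / 2))
    (hθ1 : θ1 ∈ Ioo (π / 2) π) (hc : 0 < c) :
    π / c + log (sin (min θ0 (π - θ1)))⁻¹ ≤ hDiam (Omega c θ0 θ1) := by
  have h : θ0 ≤ θ1 := (hθ0.2.trans hθ1.1).le
  rcases min_choice θ0 (π - θ1) with e | e <;> rw [e]
  · exact add_log_inv_sin_le_hDiam_Omega hθ0 hθ1 hc ⟨le_rfl, h⟩
  · rw [sin_pi_sub]
    exact add_log_inv_sin_le_hDiam_Omega hθ0 hθ1 hc ⟨h, le_rfl⟩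

/-- The derivative of the Wronskian of two solutions. -/
lemma hasDerivAt_wronskian {f g : ℝ → ℝ} (hf : ContDiff ℝ 2 f) (hg : ContDiff ℝ 2 g) (x : ℝ) :
    HasDerivAt (fun x => deriv f x * g x - f x * deriv g x)
      (deriv (deriv f) x * g x - f x * deriv (deriv g) x) x := by
  have hf1 : HasDerivAt f (deriv f x) x := (hf.differentiable (by norm_num) x).hasDerivAt
  have hg1 : HasDerivAt g (deriv g x) x := (hg.differentiable (by norm_num) x).hasDerivAt
  have hf2 : HasDerivAt (deriv f) (deriv (deriv f) x) x :=
    (hf.differentiable_deriv_two x).hasDerivAt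
  have hg2 : HasDerivAt (deriv g) (deriv (deriv g) x) x :=
    (hg.differentiable_deriv_two x).hasDerivAt
  exact ((hf2.mul hg1).sub (hf1.mul hg2)).congr_deriv (by ring)

/-- Wronskian comparison of the two ground state energies. -/
lemma gap_mem_Ioo {θ0 θ1 c lam Lam : ℝ} (hθ0 : θ0 ∈ Ioo 0 (π / 2))
    (hθ1 : θ1 ∈ Ioo (π / 2) π) (hc : 0 < c) {h1 h2 : ℝ → ℝ}
    (hC1 : ContDiff ℝ 2 h1) (hC2 : ContDiff ℝ 2 h2)
    (hpos1 : ∀ θ ∈ Ioo θ0 θ1, 0 < h1 θ) (hpos2 : ∀ θ ∈ Ioo θ0 θ1, 0 < h2 θ)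
    (hb10 : h1 θ0 = 0) (hb11 : h1 θ1 = 0) (hb20 : h2 θ0 = 0) (hb21 : h2 θ1 = 0)
    (hode1 : ∀ θ ∈ Icc θ0 θ1,
      deriv (deriv h1) θ + (lam * ((sin θ)⁻¹) ^ 2 - c ^ 2) * h1 θ = 0)
    (hode2 : ∀ θ ∈ Icc θ0 θ1,
      deriv (deriv h2) θ + (Lam * ((sin θ)⁻¹) ^ 2 - 4 * c ^ 2) * h2 θ = 0) :
    Lam - lam ∈ Ioo (3 * c ^ 2 * sin (min θ0 (π - θ1)) ^ 2) (3 * c ^ 2) := by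
  let W : ℝ → ℝ := fun x => deriv h1 x * h2 x - h1 x * deriv h2 x
  have hWc : Continuous W :=
    continuous_iff_continuousAt.2 fun x => (hasDerivAt_wronskian hC1 hC2 x).continuousAt
  have hW' : ∀ x ∈ Ioo θ0 θ1,
      deriv W x = ((Lam - lam) * ((sin x)⁻¹) ^ 2 - 3 * c ^ 2) * (h1 x * h2 x) := by
    intro x hx
    rw [(hasDerivAt_wronskian hC1 hC2 x).deriv]
    linear_combination h2 x * hode1 x (Ioo_subset_Icc_self hx) -
      h1 x * hode2 x (Ioo_subset_Icc_self hx)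
  have hW0 : W θ0 = 0 := by simp [W, hb10, hb20]
  have hW1 : W θ1 = 0 := by simp [W, hb11, hb21]
  have hlt : θ0 < θ1 := hθ0.2.trans hθ1.1
  have hs := sin_min_pos hθ0 hθ1
  have hprod : ∀ x ∈ Ioo θ0 θ1, 0 < h1 x * h2 x := fun x hx => mul_pos (hpos1 x hx) (hpos2 x hx)
  constructor <;> by_contra! hcon
  · have hanti : StrictAntiOn W (Icc θ0 θ1) := by
      refine strictAntiOn_of_deriv_neg (convex_Icc _ _) hWc.continuousOn fun x hx => ?_
      rw [interior_Icc] at hx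
      rw [hW' x hx]
      refine mul_neg_of_neg_of_pos ?_ (hprod x hx)
      have hsx := sin_min_lt hθ0 hθ1 hx
      set s := sin (min θ0 (π - θ1))
      have hx0 : 0 < sin x := hs.trans hsx
      have h3 : (Lam - lam) * (sin x)⁻¹ ^ 2 ≤ 3 * c ^ 2 * s ^ 2 * (sin x)⁻¹ ^ 2 := by gcongr
      have h4 : s ^ 2 * (sin x)⁻¹ ^ 2 < 1 := by
        rw [inv_pow, ← div_eq_mul_inv, div_lt_one (by positivity)]
        gcongr
      have h5 : 0 < 3 * c ^ 2 := by positivity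
      nlinarith
    have := hanti (left_mem_Icc.2 hlt.le) (right_mem_Icc.2 hlt.le) hlt
    linarith
  · have hder : ∀ x ∈ Ioo θ0 θ1, x ≠ π / 2 → 0 < deriv W x := by
      intro x hx hne
      rw [hW' x hx]
      refine mul_pos ?_ (hprod x hx)
      have hx0 : 0 < sin x := hs.trans (sin_min_lt hθ0 hθ1 hx)
      have hx1 : sin x < 1 := by
        rw [← cos_pi_div_two_sub]
        refine lt_of_le_of_ne (cos_le_one _) fun h => hne ?_
        have := (cos_eq_one_iff_of_lt_of_lt (by linarith [hx.2, hθ1.2, pi_pos])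
          (by linarith [hx.1, hθ0.1, pi_pos])).1 h
        linarith
      have h4 : 1 < (sin x)⁻¹ ^ 2 := one_lt_pow₀ ((one_lt_inv₀ hx0).2 hx1) two_ne_zero
      have h5 : 0 < 3 * c ^ 2 := by positivity
      nlinarith
    have hm1 : StrictMonoOn W (Icc θ0 (π / 2)) := by
      refine strictMonoOn_of_deriv_pos (convex_Icc _ _) hWc.continuousOn fun x hx => ?_
      rw [interior_Icc] at hx
      exact hder x ⟨hx.1, hx.2.trans hθ1.1⟩ hx.2.ne
    have hm2 : StrictMonoOn W (Icc (π / 2) θ1) := by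
      refine strictMonoOn_of_deriv_pos (convex_Icc _ _) hWc.continuousOn fun x hx => ?_
      rw [interior_Icc] at hx
      exact hder x ⟨hθ0.2.trans hx.1, hx.2⟩ hx.1.ne'
    have h3 := hm1 (left_mem_Icc.2 hθ0.2.le) (right_mem_Icc.2 hθ0.2.le) hθ0.2
    have h4 := hm2 (left_mem_Icc.2 hθ1.1.le) (right_mem_Icc.2 hθ1.1.le) hθ1.1
    linarith

theorem gap_diameter_combined_estimate
    (θ0 θ1 : ℝ) (hθ0 : θ0 ∈ Ioo 0 (π / 2)) (hθ1 : θ1 ∈ Ioo (π / 2) π)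
    (c : ℝ) (hc : 0 < c)
    (hstar : min θ0 (π - θ1) > π / 6)
    (hcbound : c ^ 2 ≤ π ^ 2 / (θ1 - θ0) ^ 2 *
      (4 * Real.sin (min θ0 (π - θ1)) ^ 2 - 1) / (4 - Real.sin (min θ0 (π - θ1)) ^ 2))
    (lam Lam : ℝ)
    (h1 h2 : ℝ → ℝ) (hC1 : ContDiff ℝ 2 h1) (hC2 : ContDiff ℝ 2 h2)
    (hpos1 : ∀ θ ∈ Ioo θ0 θ1, 0 < h1 θ) (hpos2 : ∀ θ ∈ Ioo θ0 θ1, 0 < h2 θ)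
    (hb10 : h1 θ0 = 0) (hb11 : h1 θ1 = 0) (hb20 : h2 θ0 = 0) (hb21 : h2 θ1 = 0)
    (hode1 : ∀ θ ∈ Icc θ0 θ1,
      deriv (deriv h1) θ + (lam * ((Real.sin θ)⁻¹) ^ 2 - c ^ 2) * h1 θ = 0)
    (hode2 : ∀ θ ∈ Icc θ0 θ1,
      deriv (deriv h2) θ + (Lam * ((Real.sin θ)⁻¹) ^ 2 - 4 * c ^ 2) * h2 θ = 0) :
    let θs := min θ0 (π - θ1)
    let a := Real.cosh (π / c) + Real.cos θs ^ 2
    let η := Real.cos θs ^ 2 / Real.sinh (π / c) +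
      Real.sqrt (1 - Real.sin θs ^ 4) / (a + Real.sqrt (a ^ 2 - 1))
    let D := hDiam (Omega c θ0 θ1)
    Real.sin θs ^ 2 * (1 + c / π * Real.log ((Real.sin θs)⁻¹)) ^ 2 <
        (Lam - lam) * D ^ 2 / (3 * π ^ 2) ∧
      (Lam - lam) * D ^ 2 / (3 * π ^ 2) <
        (1 + c / π * (2 * Real.log ((Real.sin θs)⁻¹) + η)) ^ 2 := by
  intro θs a η D
  obtain ⟨hg1, hg2⟩ := gap_mem_Ioo hθ0 hθ1 hc hC1 hC2 hpos1 hpos2 hb10 hb11 hb20 hb21 hode1 hode2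
  have hs : 0 < Real.sin θs := sin_min_pos hθ0 hθ1
  have hD1 : π / c + Real.log (Real.sin θs)⁻¹ ≤ D :=
    add_log_inv_sin_min_le_hDiam_Omega hθ0 hθ1 hc
  have hD2 : D ≤ π / c + 2 * Real.log (Real.sin θs)⁻¹ + η := hDiam_Omega_le hθ0 hθ1 hc
  have hlog : 0 ≤ Real.log (Real.sin θs)⁻¹ :=
    Real.log_nonneg ((one_le_inv₀ hs).2 (Real.sin_le_one θs))
  have hπ := Real.pi_pos
  have hD0 : 0 < D := lt_of_lt_of_le (by positivity) hD1
  have hmid : ∀ k : ℝ, k * 3 * c ^ 2 * D ^ 2 / (3 * π ^ 2) = k * (c / π * D) ^ 2 := by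
    intro k
    field_simp
  have hcD : 0 ≤ c / π * D := by positivity
  have hunit : c / π * (π / c) = 1 := by field_simp
  constructor
  · calc Real.sin θs ^ 2 * (1 + c / π * Real.log ((Real.sin θs)⁻¹)) ^ 2
        = Real.sin θs ^ 2 * (c / π * (π / c + Real.log ((Real.sin θs)⁻¹))) ^ 2 := by
          rw [mul_add, hunit]
      _ ≤ Real.sin θs ^ 2 * (c / π * D) ^ 2 := by gcongr
      _ = Real.sin θs ^ 2 * 3 * c ^ 2 * D ^ 2 / (3 * π ^ 2) := (hmid _).symm
      _ < (Lam - lam) * D ^ 2 / (3 * π ^ 2) := by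
          gcongr
          linarith
  · calc (Lam - lam) * D ^ 2 / (3 * π ^ 2) < 1 * 3 * c ^ 2 * D ^ 2 / (3 * π ^ 2) := by
          gcongr
          linarith
      _ = (c / π * D) ^ 2 := by rw [hmid, one_mul]
      _ ≤ (c / π * (π / c + 2 * Real.log (Real.sin θs)⁻¹ + η)) ^ 2 := by gcongr
      _ = (1 + c / π * (2 * Real.log ((Real.sin θs)⁻¹) + η)) ^ 2 := by
          rw [add_assoc, mul_add, hunit]
end

section
/- Suppose c > π, θ* > π/6, sin(θ*) ≥ exp(π/c − 1), and c² ≤ (π²/(θ1 − θ0)²)(4 sin²θ* − 1)/(4 − sin²θ*). Let λ, Λ ∈ ℝ admit twice continuously differentiable positive Dirichlet solutions: h1 > 0 on (θ0,θ1), h1(θ0) = h1(θ1) = 0, h1'' + (λ (csc θ)² − c²) h1 = 0; and h2 > 0 on (θ0,θ1), h2(θ0) = h2(θ1) = 0, h2'' + (Λ (csc θ)² − 4c²) h2 = 0. Then Λ − λ > 3π²/D², where D = D_{c,θ0,θ1} is the hyperbolic diameter of Ω_{c,θ0,θ1}. -/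
open Real Set

/-- Two positive Dirichlet solutions with weight `csc²` on an interval inside `(0, π)`: the
difference of the eigenvalues is `3c²` times a value of `sin²` at an interior point. -/
theorem exists_gap_eq_sin_sq {θ0 θ1 c lam Lam : ℝ} {h1 h2 : ℝ → ℝ} (hlt : θ0 < θ1)
    (hsin : ∀ θ ∈ Ioo θ0 θ1, Real.sin θ ≠ 0)
    (hC1 : ContDiff ℝ 2 h1) (hC2 : ContDiff ℝ 2 h2)
    (hpos1 : ∀ θ ∈ Ioo θ0 θ1, 0 < h1 θ) (hpos2 : ∀ θ ∈ Ioo θ0 θ1, 0 < h2 θ)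
    (hb10 : h1 θ0 = 0) (hb11 : h1 θ1 = 0) (hb20 : h2 θ0 = 0) (hb21 : h2 θ1 = 0)
    (hode1 : ∀ θ ∈ Icc θ0 θ1,
      deriv (deriv h1) θ + (lam * ((Real.sin θ)⁻¹) ^ 2 - c ^ 2) * h1 θ = 0)
    (hode2 : ∀ θ ∈ Icc θ0 θ1,
      deriv (deriv h2) θ + (Lam * ((Real.sin θ)⁻¹) ^ 2 - 4 * c ^ 2) * h2 θ = 0) :
    ∃ ξ ∈ Ioo θ0 θ1, Lam - lam = 3 * c ^ 2 * Real.sin ξ ^ 2 := by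
  have hd {h : ℝ → ℝ} (hC : ContDiff ℝ 2 h) (t : ℝ) :
      HasDerivAt h (deriv h t) t ∧ HasDerivAt (deriv h) (deriv (deriv h) t) t := by
    have hC' : ContDiff ℝ 1 (deriv h) :=
      (contDiff_succ_iff_deriv.1 (by simpa [one_add_one_eq_two] using hC : ContDiff ℝ (1 + 1) h)).2.2
    exact ⟨(hC.differentiable (by norm_num) t).hasDerivAt,
      (hC'.differentiable (by norm_num) t).hasDerivAt⟩
  have hW (t : ℝ) := ((hd hC1 t).1.mul (hd hC2 t).2).sub ((hd hC2 t).1.mul (hd hC1 t).2)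
  obtain ⟨ξ, hξ, h⟩ := exists_hasDerivAt_eq_zero hlt
    (fun t _ => (hW t).continuousAt.continuousWithinAt)
    (by simp [hb10, hb11, hb20, hb21]) (fun t _ => hW t)
  refine ⟨ξ, hξ, ?_⟩
  have e1 := hode1 ξ (Ioo_subset_Icc_self hξ)
  have e2 := hode2 ξ (Ioo_subset_Icc_self hξ)
  have hz : (3 * c ^ 2 - (Lam - lam) * ((Real.sin ξ)⁻¹) ^ 2) * (h1 ξ * h2 ξ) = 0 := by
    linear_combination h - h1 ξ * e2 + h2 ξ * e1
  have hz' := (mul_eq_zero.1 hz).resolve_right (mul_pos (hpos1 ξ hξ) (hpos2 ξ hξ)).ne'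
  have hs := hsin ξ hξ
  field_simp at hz'
  linarith

theorem sub_mul_sinh_le_cosh_sub (a b : ℝ) : (b - a) * sinh a ≤ cosh b - cosh a := by
  have e1 : exp b = exp a * exp (b - a) := by rw [← exp_add]; ring_nf
  have e2 : exp (-b) = exp (-a) * exp (a - b) := by rw [← exp_add]; ring_nf
  have i1 := mul_le_mul_of_nonneg_left (add_one_le_exp (b - a)) (exp_pos a).le
  have i2 := mul_le_mul_of_nonneg_left (add_one_le_exp (a - b)) (exp_pos (-a)).le
  rw [sinh_eq, cosh_eq, cosh_eq, e1, e2]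
  linarith

theorem mul_cosh_div_le_cosh {u s : ℝ} (hu : 0 < u) (hus : u ≤ s) (hs : s ≤ 1) :
    s * cosh (u / s) ≤ cosh u := by
  have hs0 : 0 < s := hu.trans_le hus
  have hv : u / s ≤ 1 := (div_le_one hs0).2 hus
  have hu' : u = s * (u / s) := by field_simp
  have hv0 : 0 < u / s := div_pos hu hs0
  generalize u / s = v at *
  subst hu'
  have h := sub_mul_sinh_le_cosh_sub v (s * v)
  have hsh : 0 ≤ sinh v := (sinh_pos_iff.2 hv0).le
  have h1 : v * sinh v ≤ cosh v :=
    (mul_le_of_le_one_left hsh hv).trans (sinh_lt_cosh v).le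
  nlinarith [mul_le_mul_of_nonneg_left h1 (sub_nonneg.2 hs)]

/-- If `cosh` of the hyperbolic distance is at least `cosh v`, the distance is at least `v`. -/
theorem le_hDist {p q : ℝ × ℝ} {v : ℝ}
    (h : cosh v ≤ 1 + ((q.1 - p.1) ^ 2 + (q.2 - p.2) ^ 2) / (2 * p.2 * q.2)) :
    v ≤ hDist p q := by
  unfold hDist
  have hs : sinh v ≤ √((1 + ((q.1 - p.1) ^ 2 + (q.2 - p.2) ^ 2) / (2 * p.2 * q.2)) ^ 2 - 1) := by
    apply Real.le_sqrt_of_sq_le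
    rw [sinh_sq]
    have := cosh_pos v
    gcongr
  calc v = log (cosh v + sinh v) := by rw [cosh_add_sinh, log_exp]
    _ ≤ _ := log_le_log (by rw [cosh_add_sinh]; exact exp_pos v) (add_le_add h hs)

theorem hDist_le {p q : ℝ × ℝ} (hp : 0 < p.2) (hq : 0 < q.2) :
    hDist p q ≤ 2 * (1 + ((q.1 - p.1) ^ 2 + (q.2 - p.2) ^ 2) / (2 * p.2 * q.2)) := by
  unfold hDist
  have hA : 0 ≤ 1 + ((q.1 - p.1) ^ 2 + (q.2 - p.2) ^ 2) / (2 * p.2 * q.2) := by positivity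
  set A := 1 + ((q.1 - p.1) ^ 2 + (q.2 - p.2) ^ 2) / (2 * p.2 * q.2)
  have hs : √(A ^ 2 - 1) ≤ A := Real.sqrt_le_iff.2 ⟨hA, by linarith⟩
  linarith [Real.log_le_self (add_nonneg hA (Real.sqrt_nonneg (A ^ 2 - 1)))]

/-- The argument of `arcosh` in the hyperbolic distance, in polar coordinates. -/
theorem cosh_hDist_polar {r ρ α β : ℝ} (hr : r ≠ 0) (hρ : ρ ≠ 0)
    (hα : Real.sin α ≠ 0) (hβ : Real.sin β ≠ 0) :
    1 + ((ρ * Real.cos β - r * Real.cos α) ^ 2 + (ρ * Real.sin β - r * Real.sin α) ^ 2) /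
      (2 * (r * Real.sin α) * (ρ * Real.sin β)) =
    1 + ((r / ρ + ρ / r) / 2 - Real.cos (β - α)) / (Real.sin α * Real.sin β) := by
  rw [Real.cos_sub]
  field_simp
  linear_combination r ^ 2 * Real.sin_sq_add_cos_sq α + ρ ^ 2 * Real.sin_sq_add_cos_sq β

theorem bddAbove_hDist_Omega {c θ0 θ1 s : ℝ} (hs0 : 0 < s)
    (hs : ∀ θ ∈ Ioo θ0 θ1, s < Real.sin θ) :
    BddAbove {d : ℝ | ∃ p ∈ Omega c θ0 θ1, ∃ q ∈ Omega c θ0 θ1, d = hDist p q} := by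
  refine ⟨2 * (1 + ((2 * exp (π / c)) ^ 2 + (2 * exp (π / c)) ^ 2) / (2 * s * s)), ?_⟩
  have hbd {p : ℝ × ℝ} (hp : p ∈ Omega c θ0 θ1) :
      s ≤ p.2 ∧ |p.1| ≤ exp (π / c) ∧ |p.2| ≤ exp (π / c) := by
    obtain ⟨r, θ, h1, hR, h0, h2, rfl⟩ := hp
    have h := hs θ ⟨h0, h2⟩
    refine ⟨by nlinarith, ?_, ?_⟩
    · rw [abs_mul, abs_of_pos (by linarith)]
      nlinarith [Real.abs_cos_le_one θ, abs_nonneg (Real.cos θ)]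
    · rw [abs_mul, abs_of_pos (by linarith)]
      nlinarith [Real.abs_sin_le_one θ, abs_nonneg (Real.sin θ)]
  rintro d ⟨p, hp, q, hq, rfl⟩
  obtain ⟨p1, p2, p3⟩ := hbd hp
  obtain ⟨q1, q2, q3⟩ := hbd hq
  have hp0 : 0 < p.2 := hs0.trans_le p1
  refine (hDist_le hp0 (hs0.trans_le q1)).trans ?_
  have hx {a b M : ℝ} (ha : |a| ≤ M) (hb : |b| ≤ M) : (b - a) ^ 2 ≤ (2 * M) ^ 2 := by
    rw [abs_le] at ha hb
    apply sq_le_sq'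
    · linarith
    · linarith
  have := hx p2 q2
  have := hx p3 q3
  gcongr

/-- The diagonal of `Ω` bounds its hyperbolic diameter from below. -/
theorem le_hDiam_Omega {c θ0 θ1 s v : ℝ} (hc : 0 < c) (hlt : θ0 < θ1) (hs0 : 0 < s)
    (hs : ∀ θ ∈ Ioo θ0 θ1, s < Real.sin θ)
    (hsin0 : 0 < Real.sin θ0) (hsin1 : 0 < Real.sin θ1)
    (h : cosh v < 1 + (cosh (π / c) - Real.cos (θ1 - θ0)) / (Real.sin θ0 * Real.sin θ1)) :
    v ≤ hDiam (Omega c θ0 θ1) := by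
  have hu : 0 < π / c := div_pos pi_pos hc
  let G : ℝ → ℝ := fun t =>
    1 + ((exp t / exp (π / c - t) + exp (π / c - t) / exp t) / 2 -
      Real.cos ((θ1 - t) - (θ0 + t))) / (Real.sin (θ0 + t) * Real.sin (θ1 - t))
  have hG0 : G 0 = 1 + (cosh (π / c) - Real.cos (θ1 - θ0)) /
      (Real.sin θ0 * Real.sin θ1) := by
    simp [G, cosh_eq, exp_neg, add_comm]
  have hG : ContinuousAt G 0 := by
    have : Real.sin (θ0 + 0) * Real.sin (θ1 - 0) ≠ 0 := by
      simpa using ⟨hsin0.ne', hsin1.ne'⟩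
    have h1 (t : ℝ) := (exp_pos t).ne'
    fun_prop (disch := first | assumption | exact h1 _)
  have hev : ∀ᶠ t in nhdsWithin (0 : ℝ) (Ioi 0), cosh v < G t :=
    (hG.eventually_const_lt (hG0 ▸ h)).filter_mono nhdsWithin_le_nhds
  have hsmall : ∀ᶠ t in nhdsWithin (0 : ℝ) (Ioi 0), t ∈ Ioo 0 (min (π / c) (θ1 - θ0)) :=
    Ioo_mem_nhdsGT (lt_min hu (sub_pos.2 hlt))
  obtain ⟨t, ht, ht0, htm⟩ := (hev.and hsmall).exists
  obtain ⟨htu, htL⟩ := lt_min_iff.1 htm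
  have m0 : θ0 + t ∈ Ioo θ0 θ1 := ⟨by linarith, by linarith⟩
  have m1 : θ1 - t ∈ Ioo θ0 θ1 := ⟨by linarith, by linarith⟩
  refine le_trans ?_ (le_csSup (bddAbove_hDist_Omega hs0 hs)
    ⟨_, ⟨exp t, θ0 + t, one_lt_exp_iff.2 ht0, exp_lt_exp.2 htu, m0.1, m0.2, rfl⟩,
      _, ⟨exp (π / c - t), θ1 - t, one_lt_exp_iff.2 (by linarith), exp_lt_exp.2 (by linarith),
        m1.1, m1.2, rfl⟩, rfl⟩)
  apply le_hDist
  rw [cosh_hDist_polar (exp_pos _).ne' (exp_pos _).ne' (hs0.trans (hs _ m0)).ne'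
    (hs0.trans (hs _ m1)).ne']
  exact ht.le

theorem gap_greater_than_three_pi_sq
    (θ0 θ1 : ℝ) (hθ0 : θ0 ∈ Ioo 0 (π / 2)) (hθ1 : θ1 ∈ Ioo (π / 2) π)
    (c : ℝ) (hc : π < c)
    (hstar : min θ0 (π - θ1) > π / 6)
    (hsin : Real.sin (min θ0 (π - θ1)) ≥ Real.exp (π / c - 1))
    (hcbound : c ^ 2 ≤ π ^ 2 / (θ1 - θ0) ^ 2 *
      (4 * Real.sin (min θ0 (π - θ1)) ^ 2 - 1) / (4 - Real.sin (min θ0 (π - θ1)) ^ 2))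
    (lam Lam : ℝ)
    (h1 h2 : ℝ → ℝ) (hC1 : ContDiff ℝ 2 h1) (hC2 : ContDiff ℝ 2 h2)
    (hpos1 : ∀ θ ∈ Ioo θ0 θ1, 0 < h1 θ) (hpos2 : ∀ θ ∈ Ioo θ0 θ1, 0 < h2 θ)
    (hb10 : h1 θ0 = 0) (hb11 : h1 θ1 = 0) (hb20 : h2 θ0 = 0) (hb21 : h2 θ1 = 0)
    (hode1 : ∀ θ ∈ Icc θ0 θ1,
      deriv (deriv h1) θ + (lam * ((Real.sin θ)⁻¹) ^ 2 - c ^ 2) * h1 θ = 0)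
    (hode2 : ∀ θ ∈ Icc θ0 θ1,
      deriv (deriv h2) θ + (Lam * ((Real.sin θ)⁻¹) ^ 2 - 4 * c ^ 2) * h2 θ = 0) :
    Lam - lam > 3 * π ^ 2 / (hDiam (Omega c θ0 θ1)) ^ 2 := by
  obtain ⟨h00, h0h⟩ := hθ0
  obtain ⟨h1h, h1π⟩ := hθ1
  have hc0 : 0 < c := pi_pos.trans hc
  have hlt : θ0 < θ1 := h0h.trans h1h
  have hm0 : min θ0 (π - θ1) ≤ θ0 := min_le_left _ _
  have hm1 : min θ0 (π - θ1) ≤ π - θ1 := min_le_right _ _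
  have hmpos : 0 < min θ0 (π - θ1) := lt_min h00 (by linarith)
  have hcase : Real.sin (min θ0 (π - θ1)) = Real.sin θ0 ∨
      Real.sin (min θ0 (π - θ1)) = Real.sin θ1 := by
    rcases min_choice θ0 (π - θ1) with h | h <;> rw [h]
    · exact Or.inl rfl
    · exact Or.inr (Real.sin_pi_sub θ1)
  have hsinlt : ∀ θ ∈ Ioo θ0 θ1, Real.sin (min θ0 (π - θ1)) < Real.sin θ := by
    intro θ hθ
    rcases le_total θ (π / 2) with h | h
    · exact Real.sin_lt_sin_of_lt_of_le_pi_div_two (by linarith) h (hm0.trans_lt hθ.1)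
    · rw [← Real.sin_pi_sub θ]
      exact Real.sin_lt_sin_of_lt_of_le_pi_div_two (by linarith) (by linarith)
        (hm1.trans_lt (by linarith [hθ.2]))
  have hs0 : 0 < Real.sin (min θ0 (π - θ1)) := Real.sin_pos_of_pos_of_lt_pi hmpos (by linarith)
  have hs1 : Real.sin (min θ0 (π - θ1)) < 1 := by
    simpa using hsinlt (π / 2) ⟨h0h, h1h⟩
  generalize Real.sin (min θ0 (π - θ1)) = s at *
  have hu : 0 < π / c := div_pos pi_pos hc0
  have hus : π / c ≤ s := by linarith [add_one_le_exp (π / c - 1)]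
  have hsin0 : 0 < Real.sin θ0 := Real.sin_pos_of_pos_of_lt_pi h00 (by linarith)
  have hsin1 : 0 < Real.sin θ1 := Real.sin_pos_of_pos_of_lt_pi (by linarith) h1π
  have hprod : Real.sin θ0 * Real.sin θ1 ≤ s := by
    rcases hcase with h | h <;> rw [h]
    · exact mul_le_of_le_one_right hsin0.le (Real.sin_le_one _)
    · exact mul_le_of_le_one_left hsin1.le (Real.sin_le_one _)
  have hcos : Real.cos (θ1 - θ0) < Real.sin θ0 * Real.sin θ1 := by
    have a0 := Real.cos_pos_of_mem_Ioo (x := θ0) ⟨by linarith, h0h⟩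
    have a1 := Real.cos_neg_of_pi_div_two_lt_of_lt h1h (by linarith)
    rw [Real.cos_sub]
    nlinarith [mul_neg_of_neg_of_pos a1 a0]
  have hdiag : cosh (π / c / s) <
      1 + (cosh (π / c) - Real.cos (θ1 - θ0)) / (Real.sin θ0 * Real.sin θ1) := by
    rw [← sub_lt_iff_lt_add', lt_div_iff₀ (mul_pos hsin0 hsin1)]
    nlinarith [mul_cosh_div_le_cosh hu hus hs1.le,
      mul_le_mul_of_nonneg_right hprod (cosh_pos (π / c / s)).le]
  have hv : 0 < π / c / s := div_pos hu hs0
  have hD := le_hDiam_Omega hc0 hlt hs0 hsinlt hsin0 hsin1 hdiag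
  obtain ⟨ξ, hξ, hgap⟩ := exists_gap_eq_sin_sq hlt (fun θ hθ => (hs0.trans (hsinlt θ hθ)).ne')
    hC1 hC2 hpos1 hpos2 hb10 hb11 hb20 hb21 hode1 hode2
  calc 3 * π ^ 2 / hDiam (Omega c θ0 θ1) ^ 2 ≤ 3 * π ^ 2 / (π / c / s) ^ 2 := by gcongr
    _ = 3 * c ^ 2 * s ^ 2 := by have := pi_pos.ne'; field_simp
    _ < 3 * c ^ 2 * Real.sin ξ ^ 2 := by
      have := hsinlt ξ hξ
      gcongr
    _ = Lam - lam := hgap.symm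
end
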